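/- For every positive integer n, the n×n factorial Hankel matrix H with entries H_{ij} = 1/(i+j-1)! also satisfies H · M = 1, where M is the n×n matrix with entries M_{ij} = (-1)^{n+i+j+1} · (i-1)! · j! · C(n-1, i-1) · C(n+j-1, j) · Σ_{k=0}^{i-1} C(n-i+k, j-1) · C(n+k-1, k); that is, M is a two-sided inverse of H. -/

import Mathlib

open Finset

/-- The iterated forward difference of a binomial coefficient, covering all orders. -/
lemma fwdDiff_iter_choose_eq_ite (m r y : ℕ) :
    (fwdDiff 1)^[m] (fun x ↦ x.choose r : ℕ → ℤ) y =
      if m ≤ r then (y.choose (r - m) : ℤ) else 0 := by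
  split_ifs with h
  · obtain ⟨s, rfl⟩ := Nat.exists_eq_add_of_le h
    simp [fwdDiff_iter_choose]
  · obtain ⟨s, rfl⟩ := Nat.exists_eq_add_of_lt (not_le.mp h)
    have hr := fwdDiff_iter_choose 0 r
    simp only [add_zero, Nat.choose_zero_right, Nat.cast_one] at hr
    rw [show r + s + 1 = s + 1 + r by ring, Function.iterate_add_apply, hr,
      Function.iterate_add_apply, Function.iterate_one, fwdDiff_const]
    simp [fwdDiff_iter_eq_sum_shift]

lemma sum_neg_one_pow_mul_choose_mul_choose {m N : ℕ} (h : m < N) (x r : ℕ) :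
    ∑ j ∈ range N, (-1 : ℝ) ^ j * m.choose j * (x + j).choose r =
      if m ≤ r then (-1 : ℝ) ^ m * x.choose (r - m) else 0 := by
  have key : ∑ j ∈ range N, (-1 : ℤ) ^ j * m.choose j * (x + j).choose r =
      (-1) ^ m * if m ≤ r then (x.choose (r - m) : ℤ) else 0 := by
    rw [← fwdDiff_iter_choose_eq_ite, fwdDiff_iter_eq_sum_shift, mul_sum,
      ← sum_subset (range_subset_range.2 (Nat.succ_le_of_lt h))]
    · refine sum_congr rfl fun j hj ↦ ?_
      obtain ⟨t, rfl⟩ := Nat.exists_eq_add_of_le (Nat.le_of_lt_succ (mem_range.1 hj))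
      have ht : (-1 : ℤ) ^ t * (-1) ^ t = 1 := by rw [← mul_pow]; simp
      simp only [Nat.add_sub_cancel_left, smul_eq_mul, mul_one, pow_add]
      linear_combination (-(-1 : ℤ) ^ j * (j + t).choose j * (x + j).choose r) * ht
    · intro j _ hj
      rw [mem_range, not_lt] at hj
      simp [Nat.choose_eq_zero_of_lt hj]
  have := congrArg (Int.cast : ℤ → ℝ) key
  push_cast at this
  rw [this]
  split_ifs <;> simp

/-- The coefficient form of `(1 + X) ^ (-(p + 1)) * (1 + X) ^ (p + 1) = 1`. -/
lemma sum_neg_one_pow_mul_choose_mul_choose_sub (p d : ℕ) :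
    ∑ k ∈ range (d + 1), (-1 : ℝ) ^ k * (p + k).choose k * (p + 1).choose (d - k) =
      if d = 0 then 1 else 0 := by
  have key := Ring.add_choose_eq d (Commute.all (-((p + 1 : ℕ) : ℤ)) ((p + 1 : ℕ) : ℤ))
  rw [neg_add_cancel, Ring.choose_zero_ite, Nat.sum_antidiagonal_eq_sum_range_succ_mk] at key
  have hk (k : ℕ) : Ring.choose (-((p + 1 : ℕ) : ℤ)) k = (-1) ^ k * (p + k).choose k := by
    rw [Ring.choose_neg, show ((p + 1 : ℕ) : ℤ) + k - 1 = ((p + k : ℕ) : ℤ) by push_cast; ring,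
      Ring.choose_natCast]
    simp [Int.negOnePow_def, Units.smul_def]
  simp only [hk, Ring.choose_natCast] at key
  have := congrArg (Int.cast : ℤ → ℝ) key
  push_cast at this
  rw [← this]

lemma factorial_mul_choose_div_factorial {p l : ℕ} (hl : l ≤ p) (j : ℕ) :
    ((j + 1).factorial : ℝ) * (p + 1 + j).choose (j + 1) * (1 / (j + l + 1).factorial) =
      (p - l).factorial / p.factorial * (p + 1 + j).choose (p - l) := by
  have h₁ := Nat.choose_mul_factorial_mul_factorial (show j + 1 ≤ p + 1 + j by omega)
  have h₂ := Nat.choose_mul_factorial_mul_factorial (show p - l ≤ p + 1 + j by omega)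
  rw [show p + 1 + j - (j + 1) = p by omega] at h₁
  rw [show p + 1 + j - (p - l) = j + l + 1 by omega, ← h₁] at h₂
  have h₃ : ((p + 1 + j).choose (p - l) : ℝ) * (p - l).factorial * (j + l + 1).factorial =
      (p + 1 + j).choose (j + 1) * (j + 1).factorial * p.factorial := by exact_mod_cast h₂
  have hp : (p.factorial : ℝ) ≠ 0 := by positivity
  have hj : ((j + l + 1).factorial : ℝ) ≠ 0 := by positivity
  field_simp
  linear_combination -h₃

lemma sum_choose_mul_ite_choose {p i l : ℕ} (hi : i ≤ p) (hl : l ≤ p) :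
    ∑ k ∈ range (i + 1), ((p + k).choose k : ℝ) *
      (if p - i + k ≤ p - l then
        (-1 : ℝ) ^ (p - i + k) * (p + 1).choose (p - l - (p - i + k)) else 0) =
      if i = l then (-1) ^ (p - i) else 0 := by
  rcases lt_or_ge i l with h | h
  · rw [if_neg h.ne]
    refine sum_eq_zero fun k _ ↦ ?_
    rw [if_neg (by omega), mul_zero]
  · obtain ⟨d, rfl⟩ := Nat.exists_eq_add_of_le h
    rw [← sum_subset (range_subset_range.2 (show d + 1 ≤ l + d + 1 by omega))]
    · calc _ = (-1 : ℝ) ^ (p - (l + d)) * ∑ k ∈ range (d + 1),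
            (-1 : ℝ) ^ k * (p + k).choose k * (p + 1).choose (d - k) := by
            rw [mul_sum]
            refine sum_congr rfl fun k hk ↦ ?_
            rw [mem_range] at hk
            rw [if_pos (by omega), show p - l - (p - (l + d) + k) = d - k by omega, pow_add]
            ring
        _ = _ := by simp [sum_neg_one_pow_mul_choose_mul_choose_sub]
    · intro k _ hk
      rw [mem_range] at hk
      rw [if_neg (by omega), mul_zero]

lemma sum_inverse_entry_mul_one_div_factorial {p i l : ℕ} (hi : i ≤ p) (hl : l ≤ p) :
    ∑ j ∈ range (p + 1), ((-1 : ℝ) ^ (p + 1 + (i + 1) + (j + 1) + 1) * i.factorial *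
      (j + 1).factorial * p.choose i * (p + 1 + j).choose (j + 1) *
      ∑ k ∈ range (i + 1), ((p - i + k).choose j * (p + k).choose k : ℝ)) *
        (1 / (j + l + 1).factorial) = if i = l then 1 else 0 := by
  calc _ = (-1 : ℝ) ^ (p + i) * i.factorial * p.choose i * ((p - l).factorial / p.factorial) *
        ∑ k ∈ range (i + 1), ((p + k).choose k : ℝ) * ∑ j ∈ range (p + 1),
          (-1 : ℝ) ^ j * (p - i + k).choose j * (p + 1 + j).choose (p - l) := by
        simp only [mul_sum, sum_mul]
        rw [sum_comm]
        refine sum_congr rfl fun k _ ↦ sum_congr rfl fun j _ ↦ ?_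
        have h := factorial_mul_choose_div_factorial hl j
        rw [show p + 1 + (i + 1) + (j + 1) + 1 = p + i + j + 2 * 2 by ring, pow_add _ _ (2 * 2),
          pow_add _ _ j, pow_mul]
        linear_combination ((-1 : ℝ) ^ (p + i) * (-1) ^ j * i.factorial * p.choose i *
          (p - i + k).choose j * (p + k).choose k) * h
    _ = (-1 : ℝ) ^ (p + i) * i.factorial * p.choose i * ((p - l).factorial / p.factorial) *
        if i = l then (-1) ^ (p - i) else 0 := by
        rw [← sum_choose_mul_ite_choose hi hl]
        congr 1
        refine sum_congr rfl fun k hk ↦ ?_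
        rw [mem_range] at hk
        rw [sum_neg_one_pow_mul_choose_mul_choose (by omega)]
    _ = _ := by
        split_ifs with h
        · subst h
          obtain ⟨t, rfl⟩ := Nat.exists_eq_add_of_le hi
          have hs : (-1 : ℝ) ^ (i + t + i) * (-1) ^ t = 1 := by
            rw [← pow_add, show i + t + i + t = 2 * (i + t) by ring, pow_mul]
            simp
          have hc : ((i + t).choose i : ℝ) * i.factorial * t.factorial = (i + t).factorial := by
            rw [Nat.choose_symm_add]
            exact_mod_cast Nat.add_choose_mul_factorial_mul_factorial i t
          have hf : ((i + t).factorial : ℝ) ≠ 0 := by positivity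
          rw [Nat.add_sub_cancel_left]
          field_simp
          linear_combination ((i + t).choose i * i.factorial * t.factorial : ℝ) * hs + hc
        · rw [mul_zero]

/-- **The explicit matrix `M` is a two-sided inverse of the factorial Hankel
matrix `H`:** `H * M = 1` and `M * H = 1`. Indices `i j : Fin n` correspond to
the 1-indexed entries `i+1, j+1`. -/
theorem factorial_hankel_two_sided_inverse (n : ℕ) (hn : 0 < n)
    (H M : Matrix (Fin n) (Fin n) ℝ)
    (hH : ∀ i j : Fin n, H i j = 1 / (((i : ℕ) + 1) + ((j : ℕ) + 1) - 1).factorial)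
    (hM : ∀ i j : Fin n, M i j =
      (-1 : ℝ) ^ (n + ((i : ℕ) + 1) + ((j : ℕ) + 1) + 1) *
        (((i : ℕ) + 1) - 1).factorial * ((j : ℕ) + 1).factorial *
        (n - 1).choose (((i : ℕ) + 1) - 1) *
        (n + ((j : ℕ) + 1) - 1).choose ((j : ℕ) + 1) *
        ∑ k ∈ Finset.range (((i : ℕ) + 1) - 1 + 1),
          ((n - ((i : ℕ) + 1) + k).choose (((j : ℕ) + 1) - 1) *
            (n + k - 1).choose k : ℝ)) :
    H * M = 1 ∧ M * H = 1 := by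
  obtain ⟨p, rfl⟩ : ∃ p, n = p + 1 := ⟨n - 1, by omega⟩
  have hMH : M * H = 1 := by
    ext i l
    have hi := Nat.le_of_lt_succ i.isLt
    have key := sum_inverse_entry_mul_one_div_factorial hi (Nat.le_of_lt_succ l.isLt)
    rw [← Fin.sum_univ_eq_sum_range (fun j ↦ ((-1 : ℝ) ^ (p + 1 + (i + 1) + (j + 1) + 1) *
      (i : ℕ).factorial * (j + 1).factorial * p.choose i * (p + 1 + j).choose (j + 1) *
      ∑ k ∈ range ((i : ℕ) + 1), ((p - i + k).choose j * (p + k).choose k : ℝ)) *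
        (1 / (j + l + 1).factorial))] at key
    rw [Matrix.mul_apply, Matrix.one_apply]
    simp only [Fin.ext_iff, ← key]
    refine sum_congr rfl fun j _ ↦ ?_
    rw [hM, hH]
    have hk (k : ℕ) : p + 1 + k - 1 = p + k := by omega
    have hji : p + ((j : ℕ) + 1) = p + 1 + j := by omega
    have hjl : (j : ℕ) + 1 + (l + 1) - 1 = j + l + 1 := by omega
    simp only [Nat.add_sub_cancel, Nat.add_sub_add_right, hk, hji, hjl]
  exact ⟨mul_eq_one_comm.mp hMH, hMH⟩
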